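/- Sum capacity in the strong interference regime: For the deterministic two-hop interference channel with parameters (n, m, f, n̄, m̄) satisfying m ≥ 2n, the sum capacity equals C_sum = min{n + f + (n̄ − f)⁺, 2n + 2n̄, m, 2f}; in particular it does not depend on the backward cross-link parameter m̄. -/

import Mathlib

open scoped Classical

namespace TwoHopIC

/-- The `q × q` lower-shift matrix `S^k` over `F₂`, with `(S^k)_{i,j} = 1` iff `i = j + k`. -/
def shiftMat (q k : ℕ) : Matrix (Fin q) (Fin q) (ZMod 2) :=
  Matrix.of fun i j => if (i : ℕ) = (j : ℕ) + k then 1 else 0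

/-- Forward (first-hop) signal alphabet: vectors in `F₂^q` with `q = max m n`. -/
abbrev FSig (n m : ℕ) := Fin (max m n) → ZMod 2

/-- Backward/second-hop signal alphabet: vectors in `F₂^q̄` with `q̄ = max(m̄, n̄, f)`. -/
abbrev BSig (f nb mb : ℕ) := Fin (max mb (max nb f)) → ZMod 2

/-- A blocklength-`N` code with message sets of sizes `M1`, `M2`:
causal encoders at the sources (using the messages and the overheard signals),
causal encoders at the relays (using their received signals), and decoders at the
destinations (using the `N` received signals). -/
structure Code (n m f nb mb N M1 M2 : ℕ) where
  encS1 : (t : ℕ) → Fin M1 → (Fin t → BSig f nb mb) → FSig n m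
  encS2 : (t : ℕ) → Fin M2 → (Fin t → BSig f nb mb) → FSig n m
  encR1 : (t : ℕ) → (Fin t → FSig n m) → BSig f nb mb
  encR2 : (t : ℕ) → (Fin t → FSig n m) → BSig f nb mb
  dec1 : (Fin N → BSig f nb mb) → Fin M1
  dec2 : (Fin N → BSig f nb mb) → Fin M2

variable {n m f nb mb N M1 M2 : ℕ}

/-- Given a history `h` of source signals `(X_{S1}[·], X_{S2}[·])`, the signal received by
relay 1 at time `s`: `Y_{R1}[s] = S^{q-n} X_{S1}[s] ⊕ S^{q-m} X_{S2}[s]`. -/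
def relayRx1 (n m : ℕ) {t : ℕ} (h : Fin t → FSig n m × FSig n m) (s : Fin t) : FSig n m :=
  (shiftMat (max m n) (max m n - n)).mulVec (h s).1 +
  (shiftMat (max m n) (max m n - m)).mulVec (h s).2

/-- `Y_{R2}[s] = S^{q-m} X_{S1}[s] ⊕ S^{q-n} X_{S2}[s]`. -/
def relayRx2 (n m : ℕ) {t : ℕ} (h : Fin t → FSig n m × FSig n m) (s : Fin t) : FSig n m :=
  (shiftMat (max m n) (max m n - m)).mulVec (h s).1 +
  (shiftMat (max m n) (max m n - n)).mulVec (h s).2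

/-- Relay 1 transmitted signal `X_{R1}[s]`, a causal function of `Y_{R1}[1..s-1]`. -/
def relayTx1 (C : Code n m f nb mb N M1 M2) {t : ℕ}
    (h : Fin t → FSig n m × FSig n m) (s : Fin t) : BSig f nb mb :=
  C.encR1 s.val (fun u => relayRx1 n m h ⟨u.val, lt_trans u.isLt s.isLt⟩)

/-- Relay 2 transmitted signal `X_{R2}[s]`, a causal function of `Y_{R2}[1..s-1]`. -/
def relayTx2 (C : Code n m f nb mb N M1 M2) {t : ℕ}
    (h : Fin t → FSig n m × FSig n m) (s : Fin t) : BSig f nb mb :=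
  C.encR2 s.val (fun u => relayRx2 n m h ⟨u.val, lt_trans u.isLt s.isLt⟩)

/-- Source 1 overheard signal `Y_{S1}[s] = S^{q̄-n̄} X_{R1}[s] ⊕ S^{q̄-m̄} X_{R2}[s]`. -/
def srcRx1 (C : Code n m f nb mb N M1 M2) {t : ℕ}
    (h : Fin t → FSig n m × FSig n m) (s : Fin t) : BSig f nb mb :=
  (shiftMat (max mb (max nb f)) (max mb (max nb f) - nb)).mulVec (relayTx1 C h s) +
  (shiftMat (max mb (max nb f)) (max mb (max nb f) - mb)).mulVec (relayTx2 C h s)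

/-- Source 2 overheard signal `Y_{S2}[s] = S^{q̄-n̄} X_{R2}[s] ⊕ S^{q̄-m̄} X_{R1}[s]`. -/
def srcRx2 (C : Code n m f nb mb N M1 M2) {t : ℕ}
    (h : Fin t → FSig n m × FSig n m) (s : Fin t) : BSig f nb mb :=
  (shiftMat (max mb (max nb f)) (max mb (max nb f) - nb)).mulVec (relayTx2 C h s) +
  (shiftMat (max mb (max nb f)) (max mb (max nb f) - mb)).mulVec (relayTx1 C h s)

/-- The history `(X_{S1}[1..t], X_{S2}[1..t])` of source signals determined by the
messages `(w1, w2)`: at each time the sources apply their causal encoders to their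
message and the overheard signals so far. -/
def srcHist (C : Code n m f nb mb N M1 M2) (w1 : Fin M1) (w2 : Fin M2) :
    (t : ℕ) → Fin t → FSig n m × FSig n m
  | 0 => fun i => i.elim0
  | t + 1 =>
    Fin.snoc (srcHist C w1 w2 t)
      (C.encS1 t w1 (srcRx1 C (srcHist C w1 w2 t)),
       C.encS2 t w2 (srcRx2 C (srcHist C w1 w2 t)))

/-- `(X_{S1}[t], X_{S2}[t])`. -/
def srcXat (C : Code n m f nb mb N M1 M2) (w1 : Fin M1) (w2 : Fin M2) (t : ℕ) :
    FSig n m × FSig n m :=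
  srcHist C w1 w2 (t + 1) (Fin.last t)

/-- `Y_{R1}[t]`. -/
def relayRxAt1 (C : Code n m f nb mb N M1 M2) (w1 : Fin M1) (w2 : Fin M2) (t : ℕ) :
    FSig n m :=
  relayRx1 n m (srcHist C w1 w2 (t + 1)) (Fin.last t)

/-- `Y_{R2}[t]`. -/
def relayRxAt2 (C : Code n m f nb mb N M1 M2) (w1 : Fin M1) (w2 : Fin M2) (t : ℕ) :
    FSig n m :=
  relayRx2 n m (srcHist C w1 w2 (t + 1)) (Fin.last t)

/-- `X_{R1}[t]`. -/
def relayTxAt1 (C : Code n m f nb mb N M1 M2) (w1 : Fin M1) (w2 : Fin M2) (t : ℕ) :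
    BSig f nb mb :=
  relayTx1 C (srcHist C w1 w2 (t + 1)) (Fin.last t)

/-- `X_{R2}[t]`. -/
def relayTxAt2 (C : Code n m f nb mb N M1 M2) (w1 : Fin M1) (w2 : Fin M2) (t : ℕ) :
    BSig f nb mb :=
  relayTx2 C (srcHist C w1 w2 (t + 1)) (Fin.last t)

/-- `Y_{D1}[t] = S^{q̄-f} X_{R1}[t]`. -/
def destRx1 (C : Code n m f nb mb N M1 M2) (w1 : Fin M1) (w2 : Fin M2) (t : ℕ) :
    BSig f nb mb :=
  (shiftMat (max mb (max nb f)) (max mb (max nb f) - f)).mulVec (relayTxAt1 C w1 w2 t)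

/-- `Y_{D2}[t] = S^{q̄-f} X_{R2}[t]`. -/
def destRx2 (C : Code n m f nb mb N M1 M2) (w1 : Fin M1) (w2 : Fin M2) (t : ℕ) :
    BSig f nb mb :=
  (shiftMat (max mb (max nb f)) (max mb (max nb f) - f)).mulVec (relayTxAt2 C w1 w2 t)

/-- Probability of decoding error under independent uniform messages: since the channel is
deterministic, this is the fraction of message pairs `(w1, w2)` on which some decoder errs. -/
noncomputable def errProb (C : Code n m f nb mb N M1 M2) : ℝ :=
  ((Finset.univ.filter fun w : Fin M1 × Fin M2 =>
      C.dec1 (fun t => destRx1 C w.1 w.2 t.val) ≠ w.1 ∨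
      C.dec2 (fun t => destRx2 C w.1 w.2 t.val) ≠ w.2).card : ℝ) / ((M1 : ℝ) * (M2 : ℝ))

/-- A nonnegative rate pair `(R1, R2)` is achievable if for every `ε > 0` there is a
blocklength `N ≥ 1` and a code with message sets of sizes `⌈2^(N R1)⌉`, `⌈2^(N R2)⌉`
whose probability of error is at most `ε`. -/
def Achievable (n m f nb mb : ℕ) (R1 R2 : ℝ) : Prop :=
  0 ≤ R1 ∧ 0 ≤ R2 ∧
    ∀ ε : ℝ, 0 < ε →
      ∃ N : ℕ, 0 < N ∧
        ∃ C : Code n m f nb mb N ⌈(2 : ℝ) ^ ((N : ℝ) * R1)⌉₊ ⌈(2 : ℝ) ^ ((N : ℝ) * R2)⌉₊,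
          errProb C ≤ ε

/-- The sum capacity `C_sum = sup { R1 + R2 : (R1, R2) achievable }`. -/
noncomputable def sumCapacity (n m f nb mb : ℕ) : ℝ :=
  sSup {r : ℝ | ∃ R1 R2 : ℝ, Achievable n m f nb mb R1 R2 ∧ r = R1 + R2}

end TwoHopIC

namespace TwoHopIC

section Levels

variable {q : ℕ}

/-- The entry of a signal vector at a level, with value `0` outside the range of levels. -/
def level (v : Fin q → ZMod 2) (j : ℕ) : ZMod 2 :=
  if h : j < q then v ⟨j, h⟩ else 0

theorem level_ofFn (g : ℕ → ZMod 2) {j : ℕ} (hj : j < q) :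
    level (fun i : Fin q => g i) j = g j := by
  simp [level, hj]

theorem level_add (v v' : Fin q → ZMod 2) (j : ℕ) :
    level (v + v') j = level v j + level v' j := by
  unfold level
  split_ifs <;> simp

theorem level_shift (k : ℕ) (v : Fin q → ZMod 2) (j : ℕ) :
    level ((shiftMat q k).mulVec v) j = if k ≤ j ∧ j < q then level v (j - k) else 0 := by
  unfold level
  by_cases hj : j < q
  · by_cases hk : k ≤ j
    · have hjk : j - k < q := by omega
      simp only [hj, hk, hjk, and_self, dif_pos, if_true, Matrix.mulVec, dotProduct, shiftMat,
        Matrix.of_apply, ite_mul, one_mul, zero_mul]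
      rw [Finset.sum_eq_single (⟨j - k, hjk⟩ : Fin q)]
      · rw [if_pos]
        simp only
        omega
      · intro b _ hb
        rw [if_neg]
        intro hc
        apply hb
        apply Fin.ext
        simp only
        omega
      · simp
    · simp only [hj, hk, dif_pos, false_and, if_false, Matrix.mulVec, dotProduct, shiftMat,
        Matrix.of_apply, ite_mul, one_mul, zero_mul]
      apply Finset.sum_eq_zero
      intro b _
      rw [if_neg]
      omega
  · simp [hj]

theorem ext_level {v v' : Fin q → ZMod 2} (h : ∀ j, level v j = level v' j) : v = v' := by
  funext i
  simpa [level] using h i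

/-- The `k` topmost levels of a signal vector. -/
def top (k : ℕ) (v : Fin q → ZMod 2) : Fin k → ZMod 2 :=
  fun i => level v i

/-- A link of gain `k` depends only on the `k` topmost levels of its input. -/
theorem shift_congr {k K : ℕ} (hk : k ≤ K) {v v' : Fin q → ZMod 2} (h : top K v = top K v') :
    (shiftMat q (q - k)).mulVec v = (shiftMat q (q - k)).mulVec v' := by
  apply ext_level
  intro j
  rw [level_shift, level_shift]
  split_ifs with hj
  · exact congrFun h ⟨j - (q - k), by omega⟩
  · rfl

theorem shift_zero (v : Fin q → ZMod 2) : (shiftMat q 0).mulVec v = v := by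
  apply ext_level
  intro j
  rw [level_shift]
  by_cases hj : j < q <;> simp [hj, level]

end Levels

section Trajectory

variable {n m f nb mb N M1 M2 : ℕ} (C : Code n m f nb mb N M1 M2) (w1 : Fin M1) (w2 : Fin M2)

theorem srcHist_eq (t : ℕ) (s : Fin t) : srcHist C w1 w2 t s = srcXat C w1 w2 s := by
  induction t with
  | zero => exact s.elim0
  | succ t ih =>
    refine Fin.lastCases rfl (fun s => ?_) s
    rw [Fin.val_castSucc, ← ih s]
    simp only [srcHist, Fin.snoc_castSucc]

theorem relayTx1_srcHist (t : ℕ) (s : Fin t) :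
    relayTx1 C (srcHist C w1 w2 t) s = C.encR1 s fun u => relayRxAt1 C w1 w2 u := by
  simp only [relayTx1, relayRxAt1, relayRx1, srcHist_eq, Fin.val_last]

theorem relayTx2_srcHist (t : ℕ) (s : Fin t) :
    relayTx2 C (srcHist C w1 w2 t) s = C.encR2 s fun u => relayRxAt2 C w1 w2 u := by
  simp only [relayTx2, relayRxAt2, relayRx2, srcHist_eq, Fin.val_last]

theorem relayTxAt1_eq (t : ℕ) :
    relayTxAt1 C w1 w2 t = C.encR1 t fun u => relayRxAt1 C w1 w2 u :=
  relayTx1_srcHist C w1 w2 (t + 1) (Fin.last t)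

theorem relayTxAt2_eq (t : ℕ) :
    relayTxAt2 C w1 w2 t = C.encR2 t fun u => relayRxAt2 C w1 w2 u :=
  relayTx2_srcHist C w1 w2 (t + 1) (Fin.last t)

/-- `Y_{S1}[t]`. -/
def srcRxAt1 (t : ℕ) : BSig f nb mb :=
  (shiftMat (max mb (max nb f)) (max mb (max nb f) - nb)).mulVec (relayTxAt1 C w1 w2 t) +
  (shiftMat (max mb (max nb f)) (max mb (max nb f) - mb)).mulVec (relayTxAt2 C w1 w2 t)

/-- `Y_{S2}[t]`. -/
def srcRxAt2 (t : ℕ) : BSig f nb mb :=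
  (shiftMat (max mb (max nb f)) (max mb (max nb f) - nb)).mulVec (relayTxAt2 C w1 w2 t) +
  (shiftMat (max mb (max nb f)) (max mb (max nb f) - mb)).mulVec (relayTxAt1 C w1 w2 t)

theorem srcXat_fst (t : ℕ) :
    (srcXat C w1 w2 t).1 = C.encS1 t w1 fun u => srcRxAt1 C w1 w2 u := by
  simp only [srcXat, srcHist, Fin.snoc_last]
  congr 1
  funext u
  simp only [srcRx1, srcRxAt1, relayTx1_srcHist, relayTx2_srcHist, relayTxAt1_eq, relayTxAt2_eq]

theorem srcXat_snd (t : ℕ) :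
    (srcXat C w1 w2 t).2 = C.encS2 t w2 fun u => srcRxAt2 C w1 w2 u := by
  simp only [srcXat, srcHist, Fin.snoc_last]
  congr 1
  funext u
  simp only [srcRx2, srcRxAt2, relayTx1_srcHist, relayTx2_srcHist, relayTxAt1_eq, relayTxAt2_eq]

theorem relayRxAt1_eq (t : ℕ) :
    relayRxAt1 C w1 w2 t =
      (shiftMat (max m n) (max m n - n)).mulVec (srcXat C w1 w2 t).1 +
      (shiftMat (max m n) (max m n - m)).mulVec (srcXat C w1 w2 t).2 :=
  rfl

theorem relayRxAt2_eq (t : ℕ) :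
    relayRxAt2 C w1 w2 t =
      (shiftMat (max m n) (max m n - m)).mulVec (srcXat C w1 w2 t).1 +
      (shiftMat (max m n) (max m n - n)).mulVec (srcXat C w1 w2 t).2 :=
  rfl

end Trajectory

section Converse

/-- The signal around a causal feedback loop is determined by the maps of the loop. -/
theorem eq_of_causal_loop {A B : Type*} {N : ℕ} {φ : (t : ℕ) → (Fin t → B) → A}
    {ψ : (t : ℕ) → (Fin t → A) → B} {F F' : ℕ → A → A} {G G' : ℕ → B → B} {y y' : ℕ → A}
    (hy : ∀ t, y t = F t (φ t fun u => G u (ψ u fun v => y v)))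
    (hy' : ∀ t, y' t = F' t (φ t fun u => G' u (ψ u fun v => y' v)))
    (hF : ∀ t < N, F t = F' t) (hG : ∀ t < N, G t = G' t) :
    ∀ t < N, y t = y' t := by
  intro t
  induction t using Nat.strong_induction_on with
  | _ t ih =>
    intro ht
    rw [hy, hy', hF t ht]
    congr 2
    funext u
    rw [hG u (u.isLt.trans ht)]
    congr 2
    funext v
    exact ih v (v.isLt.trans u.isLt) (v.isLt.trans (u.isLt.trans ht))

variable {n m f nb mb N M1 M2 : ℕ} (C : Code n m f nb mb N M1 M2)

/-- The message pairs that are decoded correctly. -/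
noncomputable def decoded : Finset (Fin M1 × Fin M2) :=
  Finset.univ.filter fun w =>
    C.dec1 (fun t => destRx1 C w.1 w.2 t.val) = w.1 ∧
    C.dec2 (fun t => destRx2 C w.1 w.2 t.val) = w.2

variable {C} {w w' : Fin M1 × Fin M2}

theorem fst_eq_of_destRx1 (hw : w ∈ decoded C) (hw' : w' ∈ decoded C)
    (h : ∀ t < N, destRx1 C w.1 w.2 t = destRx1 C w'.1 w'.2 t) : w.1 = w'.1 := by
  simp only [decoded, Finset.mem_filter, Finset.mem_univ, true_and] at hw hw'
  rw [← hw.1, ← hw'.1]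
  congr 1
  funext t
  exact h t t.isLt

theorem snd_eq_of_destRx2 (hw : w ∈ decoded C) (hw' : w' ∈ decoded C)
    (h : ∀ t < N, destRx2 C w.1 w.2 t = destRx2 C w'.1 w'.2 t) : w.2 = w'.2 := by
  simp only [decoded, Finset.mem_filter, Finset.mem_univ, true_and] at hw hw'
  rw [← hw.2, ← hw'.2]
  congr 1
  funext t
  exact h t t.isLt

theorem fst_eq_of_relayRxAt1 (hw : w ∈ decoded C) (hw' : w' ∈ decoded C)
    (h : ∀ t < N, relayRxAt1 C w.1 w.2 t = relayRxAt1 C w'.1 w'.2 t) : w.1 = w'.1 := by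
  refine fst_eq_of_destRx1 hw hw' fun t ht => ?_
  simp only [destRx1, relayTxAt1_eq]
  congr 2
  funext u
  exact h u (u.isLt.trans ht)

theorem relayTxAt2_congr (h : ∀ t < N, relayRxAt2 C w.1 w.2 t = relayRxAt2 C w'.1 w'.2 t) :
    ∀ t < N, relayTxAt2 C w.1 w.2 t = relayTxAt2 C w'.1 w'.2 t := by
  intro t ht
  simp only [relayTxAt2_eq]
  congr 1
  funext u
  exact h u (u.isLt.trans ht)

theorem snd_eq_of_relayRxAt2 (hw : w ∈ decoded C) (hw' : w' ∈ decoded C)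
    (h : ∀ t < N, relayRxAt2 C w.1 w.2 t = relayRxAt2 C w'.1 w'.2 t) : w.2 = w'.2 := by
  refine snd_eq_of_destRx2 hw hw' fun t ht => ?_
  simp only [destRx2, relayTxAt2_congr h t ht]

/-- Given the second message, the first one is determined by the `n` topmost levels sent by
source 1 and the `n̄` topmost levels sent by relay 2. -/
theorem fst_eq_of_top (hw : w ∈ decoded C) (hw' : w' ∈ decoded C) (h2 : w.2 = w'.2)
    (hS : ∀ t < N, top n (srcXat C w.1 w.2 t).1 = top n (srcXat C w'.1 w'.2 t).1)
    (hR : ∀ t < N, top nb (relayTxAt2 C w.1 w.2 t) = top nb (relayTxAt2 C w'.1 w'.2 t)) :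
    w.1 = w'.1 := by
  refine fst_eq_of_relayRxAt1 hw hw' ?_
  refine eq_of_causal_loop (φ := fun t => C.encS2 t w.2) (ψ := C.encR1)
    (F := fun t x => (shiftMat (max m n) (max m n - n)).mulVec (srcXat C w.1 w.2 t).1 +
      (shiftMat (max m n) (max m n - m)).mulVec x)
    (F' := fun t x => (shiftMat (max m n) (max m n - n)).mulVec (srcXat C w'.1 w'.2 t).1 +
      (shiftMat (max m n) (max m n - m)).mulVec x)
    (G := fun t x => (shiftMat (max mb (max nb f)) (max mb (max nb f) - nb)).mulVec
      (relayTxAt2 C w.1 w.2 t) +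
      (shiftMat (max mb (max nb f)) (max mb (max nb f) - mb)).mulVec x)
    (G' := fun t x => (shiftMat (max mb (max nb f)) (max mb (max nb f) - nb)).mulVec
      (relayTxAt2 C w'.1 w'.2 t) +
      (shiftMat (max mb (max nb f)) (max mb (max nb f) - mb)).mulVec x) ?_ ?_ ?_ ?_
  · intro t
    simp only [← relayTxAt1_eq]
    rw [relayRxAt1_eq, srcXat_snd]
    rfl
  · intro t
    simp only [← relayTxAt1_eq, h2]
    rw [relayRxAt1_eq, srcXat_snd]
    rfl
  · intro t ht
    simp only [shift_congr le_rfl (hS t ht)]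
  · intro t ht
    simp only [shift_congr le_rfl (hR t ht)]

/-- Given the first message, the second one is determined by the `n` topmost levels sent by
source 2 and the `n̄` topmost levels sent by relay 1. -/
theorem snd_eq_of_top (hw : w ∈ decoded C) (hw' : w' ∈ decoded C) (h1 : w.1 = w'.1)
    (hS : ∀ t < N, top n (srcXat C w.1 w.2 t).2 = top n (srcXat C w'.1 w'.2 t).2)
    (hR : ∀ t < N, top nb (relayTxAt1 C w.1 w.2 t) = top nb (relayTxAt1 C w'.1 w'.2 t)) :
    w.2 = w'.2 := by
  refine snd_eq_of_relayRxAt2 hw hw' ?_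
  refine eq_of_causal_loop (φ := fun t => C.encS1 t w.1) (ψ := C.encR2)
    (F := fun t x => (shiftMat (max m n) (max m n - m)).mulVec x +
      (shiftMat (max m n) (max m n - n)).mulVec (srcXat C w.1 w.2 t).2)
    (F' := fun t x => (shiftMat (max m n) (max m n - m)).mulVec x +
      (shiftMat (max m n) (max m n - n)).mulVec (srcXat C w'.1 w'.2 t).2)
    (G := fun t x => (shiftMat (max mb (max nb f)) (max mb (max nb f) - nb)).mulVec
      (relayTxAt1 C w.1 w.2 t) +
      (shiftMat (max mb (max nb f)) (max mb (max nb f) - mb)).mulVec x)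
    (G' := fun t x => (shiftMat (max mb (max nb f)) (max mb (max nb f) - nb)).mulVec
      (relayTxAt1 C w'.1 w'.2 t) +
      (shiftMat (max mb (max nb f)) (max mb (max nb f) - mb)).mulVec x) ?_ ?_ ?_ ?_
  · intro t
    simp only [← relayTxAt2_eq]
    rw [relayRxAt2_eq, srcXat_fst]
    rfl
  · intro t
    simp only [← relayTxAt2_eq, h1]
    rw [relayRxAt2_eq, srcXat_fst]
    rfl
  · intro t ht
    simp only [shift_congr le_rfl (hS t ht)]
  · intro t ht
    simp only [shift_congr le_rfl (hR t ht)]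

/-- If the cross link dominates, everything is determined by what relay 2 receives. -/
theorem eq_of_relayRxAt2 (hnm : n ≤ m) (hw : w ∈ decoded C) (hw' : w' ∈ decoded C)
    (h : ∀ t < N, relayRxAt2 C w.1 w.2 t = relayRxAt2 C w'.1 w'.2 t) : w = w' := by
  have h2 := snd_eq_of_relayRxAt2 hw hw' h
  refine Prod.ext (fst_eq_of_relayRxAt1 hw hw' ?_) h2
  have key : ∀ w : Fin M1 × Fin M2, ∀ t, relayRxAt1 C w.1 w.2 t =
      (shiftMat (max m n) (max m n - n)).mulVec (relayRxAt2 C w.1 w.2 t -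
        (shiftMat (max m n) (max m n - n)).mulVec (srcXat C w.1 w.2 t).2) +
      (shiftMat (max m n) (max m n - m)).mulVec (srcXat C w.1 w.2 t).2 := by
    intro w t
    rw [relayRxAt1_eq, relayRxAt2_eq, add_sub_cancel_right]
    have hz : max m n - m = 0 := by omega
    rw [hz, shift_zero, shift_zero]
  refine eq_of_causal_loop (φ := fun t => C.encS2 t w.2) (ψ := C.encR1)
    (F := fun t x => (shiftMat (max m n) (max m n - n)).mulVec (relayRxAt2 C w.1 w.2 t -
        (shiftMat (max m n) (max m n - n)).mulVec x) +
      (shiftMat (max m n) (max m n - m)).mulVec x)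
    (F' := fun t x => (shiftMat (max m n) (max m n - n)).mulVec (relayRxAt2 C w'.1 w'.2 t -
        (shiftMat (max m n) (max m n - n)).mulVec x) +
      (shiftMat (max m n) (max m n - m)).mulVec x)
    (G := fun t x => (shiftMat (max mb (max nb f)) (max mb (max nb f) - nb)).mulVec
      (relayTxAt2 C w.1 w.2 t) +
      (shiftMat (max mb (max nb f)) (max mb (max nb f) - mb)).mulVec x)
    (G' := fun t x => (shiftMat (max mb (max nb f)) (max mb (max nb f) - nb)).mulVec
      (relayTxAt2 C w'.1 w'.2 t) +
      (shiftMat (max mb (max nb f)) (max mb (max nb f) - mb)).mulVec x) ?_ ?_ ?_ ?_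
  · intro t
    rw [key]
    simp only [← relayTxAt1_eq]
    simp only [srcXat_snd C w.1 w.2 t, srcRxAt2]
  · intro t
    rw [key]
    simp only [← relayTxAt1_eq]
    simp only [srcXat_snd C w'.1 w'.2 t, srcRxAt2, h2]
  · intro t ht
    simp only [h t ht]
  · intro t ht
    simp only [relayTxAt2_congr h t ht]

variable (C)

theorem card_decoded_le_of_injOn {σ : Type*} [Fintype σ] (s : Fin M1 × Fin M2 → σ)
    (hs : Set.InjOn s (decoded C)) : (decoded C).card ≤ Fintype.card σ :=
  Finset.card_le_card_of_injOn s (fun _ _ => Finset.mem_univ _) hs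

theorem card_signal (k N : ℕ) : Fintype.card (Fin N → Fin k → ZMod 2) = 2 ^ (N * k) := by
  simp [ZMod.card, ← pow_mul, mul_comm]

theorem card_decoded_le_dest : (decoded C).card ≤ 2 ^ (N * (2 * f)) := by
  have := card_decoded_le_of_injOn C
    (fun w => ((fun t : Fin N => top f (relayTxAt1 C w.1 w.2 t)),
      (fun t : Fin N => top f (relayTxAt2 C w.1 w.2 t)))) ?_
  · rwa [Fintype.card_prod, card_signal, ← pow_add, ← mul_add, ← two_mul] at this
  · intro w hw w' hw' h
    obtain ⟨h1, h2⟩ := Prod.mk.inj h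
    exact Prod.ext
      (fst_eq_of_destRx1 hw hw' fun t ht => shift_congr le_rfl (congrFun h1 ⟨t, ht⟩))
      (snd_eq_of_destRx2 hw hw' fun t ht => shift_congr le_rfl (congrFun h2 ⟨t, ht⟩))

theorem card_decoded_le_cross (hnm : n ≤ m) : (decoded C).card ≤ 2 ^ (N * m) := by
  have := card_decoded_le_of_injOn C (fun w => fun t : Fin N => relayRxAt2 C w.1 w.2 t) ?_
  · rwa [card_signal, max_eq_left hnm] at this
  · intro w hw w' hw' h
    exact eq_of_relayRxAt2 hnm hw hw' fun t ht => congrFun h ⟨t, ht⟩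

theorem card_decoded_le_genie : (decoded C).card ≤ 2 ^ (N * (n + max f nb)) := by
  have := card_decoded_le_of_injOn C
    (fun w => ((fun t : Fin N => top n (srcXat C w.1 w.2 t).1),
      (fun t : Fin N => top (max f nb) (relayTxAt2 C w.1 w.2 t)))) ?_
  · rwa [Fintype.card_prod, card_signal, card_signal, ← pow_add, ← mul_add] at this
  · intro w hw w' hw' h
    obtain ⟨h1, h2⟩ := Prod.mk.inj h
    have hsnd : w.2 = w'.2 := snd_eq_of_destRx2 hw hw' fun t ht =>
      shift_congr (le_max_left f nb) (congrFun h2 ⟨t, ht⟩)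
    refine Prod.ext (fst_eq_of_top hw hw' hsnd (fun t ht => congrFun h1 ⟨t, ht⟩)
      fun t ht => ?_) hsnd
    funext i
    exact congrFun (congrFun h2 ⟨t, ht⟩) ⟨i, i.isLt.trans_le (le_max_right f nb)⟩

theorem card_decoded_le_fst : (decoded C).card ≤ M2 * 2 ^ (N * (n + nb)) := by
  have := card_decoded_le_of_injOn C
    (fun w => (w.2, ((fun t : Fin N => top n (srcXat C w.1 w.2 t).1),
      (fun t : Fin N => top nb (relayTxAt2 C w.1 w.2 t))))) ?_
  · rwa [Fintype.card_prod, Fintype.card_prod, card_signal, card_signal, ← pow_add, ← mul_add,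
      Fintype.card_fin] at this
  · intro w hw w' hw' h
    obtain ⟨h0, h'⟩ := Prod.mk.inj h
    obtain ⟨h1, h2⟩ := Prod.mk.inj h'
    exact Prod.ext (fst_eq_of_top hw hw' h0 (fun t ht => congrFun h1 ⟨t, ht⟩)
      fun t ht => congrFun h2 ⟨t, ht⟩) h0

theorem card_decoded_le_snd : (decoded C).card ≤ M1 * 2 ^ (N * (n + nb)) := by
  have := card_decoded_le_of_injOn C
    (fun w => (w.1, ((fun t : Fin N => top n (srcXat C w.1 w.2 t).2),
      (fun t : Fin N => top nb (relayTxAt1 C w.1 w.2 t))))) ?_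
  · rwa [Fintype.card_prod, Fintype.card_prod, card_signal, card_signal, ← pow_add, ← mul_add,
      Fintype.card_fin] at this
  · intro w hw w' hw' h
    obtain ⟨h0, h'⟩ := Prod.mk.inj h
    obtain ⟨h1, h2⟩ := Prod.mk.inj h'
    exact Prod.ext h0 (snd_eq_of_top hw hw' h0 (fun t ht => congrFun h1 ⟨t, ht⟩)
      fun t ht => congrFun h2 ⟨t, ht⟩)

theorem le_card_decoded {ε : ℝ} (h1 : 0 < M1) (h2 : 0 < M2) (hε : errProb C ≤ ε) :
    (1 - ε) * (M1 * M2) ≤ (decoded C).card := by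
  have hpos : (0 : ℝ) < (M1 : ℝ) * M2 := by positivity
  rw [errProb, div_le_iff₀ hpos] at hε
  have hcard := Finset.card_filter_add_card_filter_not
    (s := (Finset.univ : Finset (Fin M1 × Fin M2)))
    (fun w => C.dec1 (fun t => destRx1 C w.1 w.2 t.val) = w.1 ∧
      C.dec2 (fun t => destRx2 C w.1 w.2 t.val) = w.2)
  simp only [not_and_or, Finset.card_univ, Fintype.card_prod, Fintype.card_fin] at hcard
  have hcard' := congrArg (Nat.cast : ℕ → ℝ) hcard
  push_cast at hcard'
  simp only [decoded]
  simp only [ne_eq] at hε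
  linarith

theorem le_of_forall_exists_rpow_le {R K : ℝ}
    (h : ∀ ε : ℝ, 0 < ε → ε < 1 → ∃ N : ℕ, 0 < N ∧
      (1 - ε) * (2 : ℝ) ^ ((N : ℝ) * R) ≤ (2 : ℝ) ^ ((N : ℝ) * K)) : R ≤ K := by
  by_contra! hlt
  have hδ : (2 : ℝ) ^ (K - R) < 1 :=
    Real.rpow_lt_one_of_one_lt_of_neg one_lt_two (by linarith)
  have hδ0 : (0 : ℝ) < (2 : ℝ) ^ (K - R) := by positivity
  obtain ⟨N, hN, hle⟩ := h ((1 - (2 : ℝ) ^ (K - R)) / 2) (by linarith) (by linarith)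
  have hsplit : (2 : ℝ) ^ ((N : ℝ) * K) =
      (2 : ℝ) ^ ((N : ℝ) * (K - R)) * (2 : ℝ) ^ ((N : ℝ) * R) := by
    rw [← Real.rpow_add two_pos]
    ring_nf
  rw [hsplit] at hle
  have hle' := le_of_mul_le_mul_right hle (by positivity)
  have hN1 : (1 : ℝ) ≤ N := by exact_mod_cast hN
  have hmono : (2 : ℝ) ^ ((N : ℝ) * (K - R)) ≤ (2 : ℝ) ^ (K - R) :=
    Real.rpow_le_rpow_of_exponent_le one_le_two (by nlinarith)
  linarith

theorem card_messages_pos (x : ℝ) : 0 < ⌈(2 : ℝ) ^ x⌉₊ :=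
  Nat.ceil_pos.2 (by positivity)

theorem two_rpow_natCast (N k : ℕ) : (2 : ℝ) ^ ((N : ℝ) * k) = ((2 ^ (N * k) : ℕ) : ℝ) := by
  rw [← Nat.cast_mul, Real.rpow_natCast]
  push_cast
  rfl

variable {R1 R2 : ℝ}

theorem Achievable.add_le_of_card (hA : Achievable n m f nb mb R1 R2) (K : ℕ)
    (hK : ∀ (N M1 M2 : ℕ) (C : Code n m f nb mb N M1 M2), (decoded C).card ≤ 2 ^ (N * K)) :
    R1 + R2 ≤ K := by
  refine le_of_forall_exists_rpow_le fun ε h0 h1 => ?_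
  obtain ⟨N, hN, C, hC⟩ := hA.2.2 ε h0
  refine ⟨N, hN, ?_⟩
  have hlow := le_card_decoded C (card_messages_pos _) (card_messages_pos _) hC
  have hup : ((decoded C).card : ℝ) ≤ ((2 ^ (N * K) : ℕ) : ℝ) := by exact_mod_cast hK _ _ _ C
  rw [two_rpow_natCast, mul_add, Real.rpow_add two_pos]
  refine le_trans ?_ (hlow.trans hup)
  have hε : 0 ≤ 1 - ε := by linarith
  gcongr <;> exact Nat.le_ceil _

theorem Achievable.fst_le (hA : Achievable n m f nb mb R1 R2) : R1 ≤ (n + nb : ℕ) := by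
  refine le_of_forall_exists_rpow_le fun ε h0 h1 => ?_
  obtain ⟨N, hN, C, hC⟩ := hA.2.2 ε h0
  refine ⟨N, hN, ?_⟩
  have hpos := card_messages_pos ((N : ℝ) * R2)
  have hlow := le_card_decoded C (card_messages_pos _) hpos hC
  have hup := (Nat.cast_le (α := ℝ)).2 (card_decoded_le_fst C)
  rw [Nat.cast_mul] at hup
  rw [two_rpow_natCast]
  have hpos' := (Nat.cast_pos (α := ℝ)).2 hpos
  have hε : 0 ≤ 1 - ε := by linarith
  have hle := mul_le_mul_of_nonneg_left (Nat.le_ceil ((2 : ℝ) ^ ((N : ℝ) * R1))) hε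
  refine le_of_mul_le_mul_right ?_ hpos'
  nlinarith

theorem Achievable.snd_le (hA : Achievable n m f nb mb R1 R2) : R2 ≤ (n + nb : ℕ) := by
  refine le_of_forall_exists_rpow_le fun ε h0 h1 => ?_
  obtain ⟨N, hN, C, hC⟩ := hA.2.2 ε h0
  refine ⟨N, hN, ?_⟩
  have hpos := card_messages_pos ((N : ℝ) * R1)
  have hlow := le_card_decoded C hpos (card_messages_pos _) hC
  have hup := (Nat.cast_le (α := ℝ)).2 (card_decoded_le_snd C)
  rw [Nat.cast_mul] at hup
  rw [two_rpow_natCast]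
  have hpos' := (Nat.cast_pos (α := ℝ)).2 hpos
  have hε : 0 ≤ 1 - ε := by linarith
  have hle := mul_le_mul_of_nonneg_left (Nat.le_ceil ((2 : ℝ) ^ ((N : ℝ) * R2))) hε
  refine le_of_mul_le_mul_right ?_ hpos'
  nlinarith

theorem Achievable.add_le (hnm : n ≤ m) (hA : Achievable n m f nb mb R1 R2) :
    R1 + R2 ≤ (min (n + max f nb) (min (2 * n + 2 * nb) (min m (2 * f))) : ℕ) := by
  rw [Nat.cast_min, Nat.cast_min, Nat.cast_min]
  refine le_min (hA.add_le_of_card _ fun _ _ _ C => card_decoded_le_genie C)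
    (le_min ?_ (le_min (hA.add_le_of_card _ fun _ _ _ C => card_decoded_le_cross C hnm)
      (hA.add_le_of_card _ fun _ _ _ C => card_decoded_le_dest C)))
  have h1 := hA.fst_le
  have h2 := hA.snd_le
  push_cast at h1 h2 ⊢
  linarith

end Converse

section Achievability

/-- A user's share of the levels: `direct` bits per slot reach the user's relay over the direct
link and `looped` bits reach it through the other relay and the other source. The user's relay
sends these bits from level `own` on and the looped bits of the other user from level `loop` on. -/
structure LevelPlan where
  direct : ℕ
  looped : ℕ
  own : ℕ
  loop : ℕ

variable {n m f nb mb : ℕ}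

/-- The plan `P` of a user is compatible with the looped traffic of the other user's plan `Q`. -/
structure LevelPlan.Fits (n m f nb : ℕ) (P Q : LevelPlan) : Prop where
  direct_le : P.direct ≤ n
  own_le : P.own + P.direct + P.looped ≤ f
  loop_le : P.loop + Q.looped ≤ nb
  cross_le : 2 * n + P.looped + Q.looped ≤ m
  disjoint : P.loop + Q.looped ≤ P.own ∨ P.own + P.direct + P.looped ≤ P.loop

/-- The levels sent by a source: direct bits, looped bits, and the raw levels overheard in the
previous slot that carry looped bits of the other user. -/
def srcLevel (n : ℕ) (P Q : LevelPlan) (bits : ℕ → ZMod 2) (y : BSig f nb mb) (j : ℕ) : ZMod 2 :=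
  if j < n then (if j < P.direct then bits j else 0)
  else if j < n + P.looped then bits (P.direct + (j - n))
  else if j < n + P.looped + Q.looped then
    level y (max mb (max nb f) - nb + P.loop + (j - n - P.looped))
  else 0

/-- The signal of a source with the levels `srcLevel`. -/
def srcMap (P Q : LevelPlan) (bits : ℕ → ZMod 2) (y : BSig f nb mb) : FSig n m :=
  fun i => srcLevel n P Q bits y i

theorem level_srcMap (P Q : LevelPlan) (bits : ℕ → ZMod 2) (y : BSig f nb mb) {j : ℕ}
    (hj : j < max m n) : level (srcMap P Q bits y : FSig n m) j = srcLevel n P Q bits y j :=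
  level_ofFn _ hj

/-- The levels sent by a relay, from its last received signal `y` and its transmitted signal `x`
of two slots ago, whose contribution to the levels looped back by the other source it removes. -/
def relayLevel (P Q : LevelPlan) (y : FSig n m) (x : BSig f nb mb) (l : ℕ) : ZMod 2 :=
  if P.own ≤ l ∧ l < P.own + P.direct then level y (m - n + (l - P.own))
  else if P.own + P.direct ≤ l ∧ l < P.own + P.direct + P.looped then
    level y (n + Q.looped + (l - P.own - P.direct)) -
    level ((shiftMat (max mb (max nb f)) (max mb (max nb f) - mb)).mulVec x)
      (max mb (max nb f) - nb + Q.loop + (l - P.own - P.direct))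
  else if P.loop ≤ l ∧ l < P.loop + Q.looped then level y (n + (l - P.loop))
  else 0

/-- The signal of a relay with the levels `relayLevel`. -/
def relayMap (P Q : LevelPlan) (y : FSig n m) (x : BSig f nb mb) : BSig f nb mb :=
  fun i => relayLevel P Q y x i

theorem level_relayMap (P Q : LevelPlan) (y : FSig n m) (x : BSig f nb mb) {l : ℕ}
    (hl : l < max mb (max nb f)) : level (relayMap P Q y x) l = relayLevel P Q y x l :=
  level_ofFn _ hl

/-- The causal source encoder given by `srcMap`. -/
def srcEnc (P Q : LevelPlan) (bits : ℕ → ℕ → ZMod 2) :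
    (t : ℕ) → (Fin t → BSig f nb mb) → FSig n m
  | 0, _ => srcMap P Q (bits 0) (0 : BSig f nb mb)
  | t + 1, y => srcMap P Q (bits (t + 1)) (y (Fin.last t))

/-- The causal relay encoder given by `relayMap`. -/
def relayEnc (P Q : LevelPlan) : (t : ℕ) → (Fin t → FSig n m) → BSig f nb mb
  | 0, _ => 0
  | 1, y => relayMap P Q (y 0) 0
  | t + 2, y => relayMap P Q (y (Fin.last (t + 1)))
      (relayEnc P Q t fun u => y u.castSucc.castSucc)

theorem exists_srcEnc_eq (P Q : LevelPlan) (bits : ℕ → ℕ → ZMod 2) (t : ℕ)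
    (y : Fin t → BSig f nb mb) :
    ∃ z : BSig f nb mb, (srcEnc P Q bits t y : FSig n m) = srcMap P Q (bits t) z := by
  cases t with
  | zero => exact ⟨_, rfl⟩
  | succ t => exact ⟨_, rfl⟩

theorem exists_relayEnc_succ_eq (P Q : LevelPlan) (t : ℕ) (y : Fin (t + 1) → FSig n m) :
    ∃ x : BSig f nb mb, relayEnc P Q (t + 1) y = relayMap P Q (y (Fin.last t)) x := by
  cases t with
  | zero => exact ⟨_, rfl⟩
  | succ t => exact ⟨_, rfl⟩

section Delivery

variable {P Q : LevelPlan}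

theorem level_srcMap_direct (hP : P.Fits n m f nb Q) (bits : ℕ → ZMod 2) (y : BSig f nb mb)
    {j : ℕ} (hj : j < P.direct) : level (srcMap P Q bits y : FSig n m) j = bits j := by
  have := hP.direct_le
  rw [level_srcMap _ _ _ _ (by omega), srcLevel, if_pos (by omega), if_pos hj]

theorem level_srcMap_looped (hP : P.Fits n m f nb Q) (bits : ℕ → ZMod 2) (y : BSig f nb mb)
    {j : ℕ} (hj : j < P.looped) :
    level (srcMap P Q bits y : FSig n m) (n + j) = bits (P.direct + j) := by
  have := hP.cross_le
  rw [level_srcMap _ _ _ _ (by omega), srcLevel, if_neg (by omega), if_pos (by omega)]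
  congr 2
  omega

theorem level_srcMap_forward (hP : P.Fits n m f nb Q) (bits : ℕ → ZMod 2) (y : BSig f nb mb)
    {j : ℕ} (hj : j < Q.looped) :
    level (srcMap P Q bits y : FSig n m) (n + P.looped + j) =
      level y (max mb (max nb f) - nb + P.loop + j) := by
  have := hP.cross_le
  rw [level_srcMap _ _ _ _ (by omega), srcLevel, if_neg (by omega), if_neg (by omega),
    if_pos (by omega)]
  congr 2
  omega

theorem level_srcMap_bottom (hP : P.Fits n m f nb Q) (bits : ℕ → ZMod 2) (y : BSig f nb mb)
    {j : ℕ} (hj : j < n) : level (srcMap P Q bits y : FSig n m) (m - n + j) = 0 := by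
  have := hP.cross_le
  rw [level_srcMap _ _ _ _ (by omega), srcLevel, if_neg (by omega), if_neg (by omega),
    if_neg (by omega)]

theorem level_relayMap_direct (hP : P.Fits n m f nb Q) (y : FSig n m) (x : BSig f nb mb)
    {j : ℕ} (hj : j < P.direct) :
    level (relayMap P Q y x) (P.own + j) = level y (m - n + j) := by
  have := hP.own_le
  rw [level_relayMap _ _ _ _ (by omega), relayLevel, if_pos (by omega)]
  congr 2
  omega

theorem level_relayMap_looped (hP : P.Fits n m f nb Q) (y : FSig n m) (x : BSig f nb mb)
    {j : ℕ} (hj : j < P.looped) :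
    level (relayMap P Q y x) (P.own + P.direct + j) = level y (n + Q.looped + j) -
      level ((shiftMat (max mb (max nb f)) (max mb (max nb f) - mb)).mulVec x)
        (max mb (max nb f) - nb + Q.loop + j) := by
  have := hP.own_le
  have hsub : P.own + P.direct + j - P.own - P.direct = j := by omega
  rw [level_relayMap _ _ _ _ (by omega), relayLevel, if_neg (by omega), if_pos (by omega), hsub]

theorem level_relayMap_loop (hP : P.Fits n m f nb Q) (y : FSig n m) (x : BSig f nb mb)
    {j : ℕ} (hj : j < Q.looped) :
    level (relayMap P Q y x) (P.loop + j) = level y (n + j) := by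
  have := hP.loop_le
  have := hP.disjoint
  rw [level_relayMap _ _ _ _ (by omega), relayLevel, if_neg (by omega), if_neg (by omega),
    if_pos (by omega)]
  congr 2
  omega

/-- Levels above the bottom `n` are received over the cross link without interference. -/
theorem level_relayRx_upper (h : 2 * n ≤ m) (x x' : FSig n m) {j : ℕ} (hj : j < m - n) :
    level ((shiftMat (max m n) (max m n - n)).mulVec x +
      (shiftMat (max m n) (max m n - m)).mulVec x') j = level x' j := by
  have hsub : j - (max m n - m) = j := by omega
  rw [level_add, level_shift, level_shift, if_neg (by omega), if_pos (by omega), zero_add, hsub]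

theorem level_relayRx_bottom (h : 2 * n ≤ m) (x x' : FSig n m) {j : ℕ} (hj : j < n)
    (hx' : level x' (m - n + j) = 0) :
    level ((shiftMat (max m n) (max m n - n)).mulVec x +
      (shiftMat (max m n) (max m n - m)).mulVec x') (m - n + j) = level x j := by
  have hsub : m - n + j - (max m n - m) = m - n + j := by omega
  have hsub' : m - n + j - (max m n - n) = j := by omega
  rw [level_add, level_shift, level_shift, if_pos (by omega), if_pos (by omega), hsub, hsub',
    hx', add_zero]

/-- Direct bits are sent by the user's relay one slot after the source sends them. -/
theorem level_relay_direct (hP : P.Fits n m f nb Q) (hQ : Q.Fits n m f nb P)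
    {bits bits' : ℕ → ZMod 2} {z z' x : BSig f nb mb} {j : ℕ} (hj : j < P.direct) :
    level (relayMap P Q ((shiftMat (max m n) (max m n - n)).mulVec
      (srcMap P Q bits z : FSig n m) +
      (shiftMat (max m n) (max m n - m)).mulVec (srcMap Q P bits' z')) x) (P.own + j) =
      bits j := by
  have := hP.direct_le
  have := hP.cross_le
  rw [level_relayMap_direct hP _ _ hj, level_relayRx_bottom (by omega) _ _ (by omega),
    level_srcMap_direct hP _ _ hj]
  exact level_srcMap_bottom hQ _ _ (by omega)

/-- Looped bits are sent by the user's relay three slots after the source sends them. -/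
theorem level_relay_looped (hP : P.Fits n m f nb Q) (hQ : Q.Fits n m f nb P)
    {bits bits' : ℕ → ZMod 2} {z x x' : BSig f nb mb} {u v : FSig n m} {j : ℕ}
    (hj : j < P.looped) :
    level (relayMap P Q ((shiftMat (max m n) (max m n - n)).mulVec v +
      (shiftMat (max m n) (max m n - m)).mulVec (srcMap Q P bits'
        ((shiftMat (max mb (max nb f)) (max mb (max nb f) - nb)).mulVec
          (relayMap Q P ((shiftMat (max m n) (max m n - n)).mulVec u +
            (shiftMat (max m n) (max m n - m)).mulVec (srcMap P Q bits z)) x') +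
        (shiftMat (max mb (max nb f)) (max mb (max nb f) - mb)).mulVec x)))
      x) (P.own + P.direct + j) = bits (P.direct + j) := by
  have := hP.cross_le
  have := hQ.loop_le
  have hsub : max mb (max nb f) - nb + Q.loop + j - (max mb (max nb f) - nb) = Q.loop + j := by
    omega
  rw [level_relayMap_looped hP _ _ hj, level_relayRx_upper (by omega) _ _ (by omega),
    level_srcMap_forward hQ _ _ hj, level_add, add_sub_cancel_right, level_shift,
    if_pos (by omega), hsub, level_relayMap_loop hQ _ _ hj,
    level_relayRx_upper (by omega) _ _ (by omega), level_srcMap_looped hP _ _ hj]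

end Delivery

section LoopCode

variable {T M M1 M2 : ℕ}

/-- The bit of a message with index `j` in slot `t`, or `0` if there is none. -/
def messageBit {r : ℕ} (e : Fin M ≃ (Fin T × Fin r → ZMod 2)) (w : Fin M) (t j : ℕ) : ZMod 2 :=
  if h : t < T ∧ j < r then e w (⟨t, h.1⟩, ⟨j, h.2⟩) else 0

/-- The decoder reading direct bits one slot and looped bits three slots after their slot. -/
def loopDec (P : LevelPlan) (e : Fin M ≃ (Fin T × Fin (P.direct + P.looped) → ZMod 2))
    (y : Fin (T + 3) → BSig f nb mb) : Fin M :=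
  e.symm fun i =>
    if (i.2 : ℕ) < P.direct then
      level (y ⟨i.1 + 1, by omega⟩) (max mb (max nb f) - f + (P.own + i.2))
    else level (y ⟨i.1 + 3, by omega⟩) (max mb (max nb f) - f + (P.own + i.2))

/-- The code in which each source returns to its relay the other user's looped bits. -/
def loopCode (P Q : LevelPlan)
    (e1 : Fin M1 ≃ (Fin T × Fin (P.direct + P.looped) → ZMod 2))
    (e2 : Fin M2 ≃ (Fin T × Fin (Q.direct + Q.looped) → ZMod 2)) :
    Code n m f nb mb (T + 3) M1 M2 where
  encS1 t w := srcEnc P Q (messageBit e1 w) t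
  encS2 t w := srcEnc Q P (messageBit e2 w) t
  encR1 := relayEnc P Q
  encR2 := relayEnc Q P
  dec1 := loopDec P e1
  dec2 := loopDec Q e2

theorem loopDec_eq {P Q : LevelPlan} (hP : P.Fits n m f nb Q)
    (e : Fin M ≃ (Fin T × Fin (P.direct + P.looped) → ZMod 2)) (w : Fin M)
    (x : ℕ → BSig f nb mb)
    (hd : ∀ t j, j < P.direct → level (x (t + 1)) (P.own + j) = messageBit e w t j)
    (hl : ∀ t j, j < P.looped → level (x (t + 3)) (P.own + P.direct + j) =
      messageBit e w t (P.direct + j)) :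
    loopDec P e (fun t => (shiftMat (max mb (max nb f)) (max mb (max nb f) - f)).mulVec
      (x t)) = w := by
  rw [loopDec, Equiv.symm_apply_eq]
  funext ⟨t, j⟩
  have hbit : messageBit e w t j = e w (t, j) := by simp [messageBit]
  have := hP.own_le
  have hsub : max mb (max nb f) - f + (P.own + j) - (max mb (max nb f) - f) = P.own + j := by
    omega
  dsimp only
  have hrange : max mb (max nb f) - f ≤ max mb (max nb f) - f + (P.own + j) ∧
      max mb (max nb f) - f + (P.own + j) < max mb (max nb f) := by omega
  rw [← hbit, level_shift, level_shift, if_pos hrange, if_pos hrange, hsub]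
  split_ifs with hj
  · exact hd t j hj
  · have hj' : (j : ℕ) = P.direct + (j - P.direct) := by omega
    rw [hj', ← add_assoc]
    exact hl t _ (by omega)

variable {P Q : LevelPlan} (e1 : Fin M1 ≃ (Fin T × Fin (P.direct + P.looped) → ZMod 2))
  (e2 : Fin M2 ≃ (Fin T × Fin (Q.direct + Q.looped) → ZMod 2))

theorem dec1_loopCode (hP : P.Fits n m f nb Q) (hQ : Q.Fits n m f nb P)
    (w1 : Fin M1) (w2 : Fin M2) :
    (loopCode P Q e1 e2 : Code n m f nb mb (T + 3) M1 M2).dec1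
      (fun t => destRx1 (loopCode P Q e1 e2 : Code n m f nb mb (T + 3) M1 M2)
        w1 w2 t) = w1 := by
  set C : Code n m f nb mb (T + 3) M1 M2 := loopCode P Q e1 e2
  have hsrc1 : ∀ t, ∃ z : BSig f nb mb,
      (srcXat C w1 w2 t).1 = srcMap P Q (messageBit e1 w1 t) z := fun t => by
    rw [srcXat_fst]
    exact exists_srcEnc_eq _ _ _ _ _
  have hsrc2 : ∀ t, (srcXat C w1 w2 (t + 1)).2 =
      srcMap Q P (messageBit e2 w2 (t + 1)) (srcRxAt2 C w1 w2 t) := fun t => by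
    rw [srcXat_snd]
    rfl
  have hsrc2' : ∀ t, ∃ z : BSig f nb mb,
      (srcXat C w1 w2 t).2 = srcMap Q P (messageBit e2 w2 t) z := fun t => by
    rw [srcXat_snd]
    exact exists_srcEnc_eq _ _ _ _ _
  have hrel1 : ∀ t, ∃ x, relayTxAt1 C w1 w2 (t + 1) =
      relayMap P Q (relayRxAt1 C w1 w2 t) x := fun t => by
    rw [relayTxAt1_eq]
    exact exists_relayEnc_succ_eq _ _ _ _
  have hrel2 : ∀ t, ∃ x, relayTxAt2 C w1 w2 (t + 1) =
      relayMap Q P (relayRxAt2 C w1 w2 t) x := fun t => by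
    rw [relayTxAt2_eq]
    exact exists_relayEnc_succ_eq _ _ _ _
  have hrel1' : ∀ t, relayTxAt1 C w1 w2 (t + 2) =
      relayMap P Q (relayRxAt1 C w1 w2 (t + 1)) (relayTxAt1 C w1 w2 t) := fun t => by
    rw [relayTxAt1_eq, relayTxAt1_eq]
    rfl
  refine loopDec_eq hP e1 w1 (relayTxAt1 C w1 w2) (fun t j hj => ?_) (fun t j hj => ?_)
  · obtain ⟨x, hx⟩ := hrel1 t
    obtain ⟨z, hz⟩ := hsrc1 t
    obtain ⟨z', hz'⟩ := hsrc2' t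
    rw [hx, relayRxAt1_eq, hz, hz']
    exact level_relay_direct hP hQ hj
  · obtain ⟨x, hx⟩ := hrel2 t
    obtain ⟨z, hz⟩ := hsrc1 t
    rw [hrel1' (t + 1), relayRxAt1_eq, hsrc2 (t + 1), srcRxAt2, hx, relayRxAt2_eq, hz,
      add_comm ((shiftMat (max m n) (max m n - m)).mulVec (srcMap P Q _ z))]
    exact level_relay_looped hP hQ hj

theorem dec2_loopCode (hP : P.Fits n m f nb Q) (hQ : Q.Fits n m f nb P)
    (w1 : Fin M1) (w2 : Fin M2) :
    (loopCode P Q e1 e2 : Code n m f nb mb (T + 3) M1 M2).dec2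
      (fun t => destRx2 (loopCode P Q e1 e2 : Code n m f nb mb (T + 3) M1 M2)
        w1 w2 t) = w2 := by
  set C : Code n m f nb mb (T + 3) M1 M2 := loopCode P Q e1 e2
  have hsrc2 : ∀ t, ∃ z : BSig f nb mb,
      (srcXat C w1 w2 t).2 = srcMap Q P (messageBit e2 w2 t) z := fun t => by
    rw [srcXat_snd]
    exact exists_srcEnc_eq _ _ _ _ _
  have hsrc1 : ∀ t, (srcXat C w1 w2 (t + 1)).1 =
      srcMap P Q (messageBit e1 w1 (t + 1)) (srcRxAt1 C w1 w2 t) := fun t => by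
    rw [srcXat_fst]
    rfl
  have hsrc1' : ∀ t, ∃ z : BSig f nb mb,
      (srcXat C w1 w2 t).1 = srcMap P Q (messageBit e1 w1 t) z := fun t => by
    rw [srcXat_fst]
    exact exists_srcEnc_eq _ _ _ _ _
  have hrel2 : ∀ t, ∃ x, relayTxAt2 C w1 w2 (t + 1) =
      relayMap Q P (relayRxAt2 C w1 w2 t) x := fun t => by
    rw [relayTxAt2_eq]
    exact exists_relayEnc_succ_eq _ _ _ _
  have hrel1 : ∀ t, ∃ x, relayTxAt1 C w1 w2 (t + 1) =
      relayMap P Q (relayRxAt1 C w1 w2 t) x := fun t => by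
    rw [relayTxAt1_eq]
    exact exists_relayEnc_succ_eq _ _ _ _
  have hrel2' : ∀ t, relayTxAt2 C w1 w2 (t + 2) =
      relayMap Q P (relayRxAt2 C w1 w2 (t + 1)) (relayTxAt2 C w1 w2 t) := fun t => by
    rw [relayTxAt2_eq, relayTxAt2_eq]
    rfl
  refine loopDec_eq hQ e2 w2 (relayTxAt2 C w1 w2) (fun t j hj => ?_) (fun t j hj => ?_)
  · obtain ⟨x, hx⟩ := hrel2 t
    obtain ⟨z, hz⟩ := hsrc2 t
    obtain ⟨z', hz'⟩ := hsrc1' t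
    rw [hx, relayRxAt2_eq, hz, hz', add_comm]
    exact level_relay_direct hQ hP hj
  · obtain ⟨x, hx⟩ := hrel1 t
    obtain ⟨z, hz⟩ := hsrc2 t
    rw [hrel2' (t + 1), relayRxAt2_eq, hsrc1 (t + 1), srcRxAt1, hx, relayRxAt1_eq, hz,
      add_comm ((shiftMat (max m n) (max m n - m)).mulVec (srcMap P Q _ _))]
    exact level_relay_looped hQ hP hj

theorem errProb_loopCode (hP : P.Fits n m f nb Q) (hQ : Q.Fits n m f nb P) :
    errProb (loopCode P Q e1 e2 : Code n m f nb mb (T + 3) M1 M2) = 0 := by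
  simp [errProb, dec1_loopCode e1 e2 hP hQ, dec2_loopCode e1 e2 hP hQ]

end LoopCode

theorem card_messages_eq (r T : ℕ) :
    ⌈(2 : ℝ) ^ (((T + 3 : ℕ) : ℝ) * ((r * T : ℕ) / (T + 3 : ℕ) : ℝ))⌉₊ = 2 ^ (T * r) := by
  rw [mul_div_cancel₀ _ (by positivity), Real.rpow_natCast, mul_comm r T]
  exact_mod_cast Nat.ceil_natCast (R := ℝ) (2 ^ (T * r))

theorem nonempty_messageEquiv {M T r : ℕ} (h : M = 2 ^ (T * r)) :
    Nonempty (Fin M ≃ (Fin T × Fin r → ZMod 2)) :=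
  ⟨Fintype.equivOfCardEq (by simp [h, ZMod.card])⟩

theorem achievable_of_fits {P Q : LevelPlan} (hP : P.Fits n m f nb Q) (hQ : Q.Fits n m f nb P)
    (T : ℕ) :
    Achievable n m f nb mb (((P.direct + P.looped) * T : ℕ) / (T + 3 : ℕ) : ℝ)
      (((Q.direct + Q.looped) * T : ℕ) / (T + 3 : ℕ) : ℝ) := by
  refine ⟨by positivity, by positivity, fun ε hε => ⟨T + 3, by omega, ?_⟩⟩
  obtain ⟨e1⟩ := nonempty_messageEquiv (card_messages_eq (P.direct + P.looped) T)
  obtain ⟨e2⟩ := nonempty_messageEquiv (card_messages_eq (Q.direct + Q.looped) T)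
  exact ⟨loopCode P Q e1 e2, (errProb_loopCode e1 e2 hP hQ).le.trans hε.le⟩

/-- The plan for `d` direct and `b` looped bits per slot, with `b'` looped bits of the other
user. -/
def LevelPlan.ofSizes (f nb d b b' : ℕ) : LevelPlan :=
  if nb < f then ⟨d, b, b', 0⟩ else ⟨d, b, 0, d + b⟩

theorem LevelPlan.direct_ofSizes (f nb d b b' : ℕ) : (ofSizes f nb d b b').direct = d := by
  unfold ofSizes
  split_ifs <;> rfl

theorem LevelPlan.looped_ofSizes (f nb d b b' : ℕ) : (ofSizes f nb d b b').looped = b := by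
  unfold ofSizes
  split_ifs <;> rfl

theorem LevelPlan.fits_ofSizes {d b d' b' : ℕ} (hd : d ≤ n) (hf : d + b ≤ f) (hb : b' ≤ nb)
    (hm : 2 * n + b + b' ≤ m) (hmax : d + b + b' ≤ max f nb) :
    (ofSizes f nb d b b').Fits n m f nb (ofSizes f nb d' b' b) := by
  have hl := looped_ofSizes f nb d' b' b
  unfold ofSizes at hl ⊢
  split_ifs at hl ⊢ <;> constructor <;> simp only at hl ⊢ <;> omega

theorem exists_fits (h : 2 * n ≤ m) : ∃ P Q : LevelPlan, P.Fits n m f nb Q ∧ Q.Fits n m f nb P ∧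
    P.direct + P.looped + (Q.direct + Q.looped) =
      min (n + max f nb) (min (2 * n + 2 * nb) (min m (2 * f))) := by
  generalize hK : min (n + max f nb) (min (2 * n + 2 * nb) (min m (2 * f))) = K
  refine ⟨.ofSizes f nb (min n ((K + 1) / 2)) ((K + 1) / 2 - n) (K / 2 - n),
    .ofSizes f nb (min n (K / 2)) (K / 2 - n) ((K + 1) / 2 - n), LevelPlan.fits_ofSizes ?_ ?_ ?_ ?_ ?_,
    LevelPlan.fits_ofSizes ?_ ?_ ?_ ?_ ?_, ?_⟩
  all_goals try simp only [LevelPlan.direct_ofSizes, LevelPlan.looped_ofSizes]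
  all_goals omega

end Achievability

theorem sumCapacity_eq (n m f nb mb : ℕ) (h : 2 * n ≤ m) :
    sumCapacity n m f nb mb =
      (min (n + max f nb) (min (2 * n + 2 * nb) (min m (2 * f))) : ℕ) := by
  obtain ⟨P, Q, hP, hQ, hK⟩ := exists_fits (f := f) (nb := nb) h
  have hup : ∀ r ∈ {r : ℝ | ∃ R1 R2 : ℝ, Achievable n m f nb mb R1 R2 ∧ r = R1 + R2},
      r ≤ (min (n + max f nb) (min (2 * n + 2 * nb) (min m (2 * f))) : ℕ) := by
    rintro r ⟨R1, R2, hA, rfl⟩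
    exact hA.add_le (by omega)
  refine le_antisymm (csSup_le ⟨_, _, _, achievable_of_fits hP hQ 0, rfl⟩ hup) ?_
  have hlow : ∀ T : ℕ, ((P.direct + P.looped + (Q.direct + Q.looped) : ℕ) : ℝ) * T ≤
      sumCapacity n m f nb mb * (T + 3) := fun T => by
    have := le_csSup ⟨_, hup⟩ ⟨_, _, achievable_of_fits hP hQ T, rfl⟩
    rw [← add_div, div_le_iff₀ (by positivity)] at this
    rw [sumCapacity]
    push_cast at this ⊢
    linarith
  rw [← hK]
  by_contra! hlt
  obtain ⟨T, hT⟩ := exists_nat_gt (3 * sumCapacity n m f nb mb /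
    (((P.direct + P.looped + (Q.direct + Q.looped) : ℕ) : ℝ) - sumCapacity n m f nb mb))
  rw [div_lt_iff₀ (by linarith)] at hT
  have := hlow T
  linarith

end TwoHopIC

open TwoHopIC in
/-- Sum capacity in the strong interference regime; it does not depend on the backward
cross-link parameter `m̄`. -/
theorem sumCapacity_strong (n m f nb mb : ℕ) (h : 2 * n ≤ m) :
    sumCapacity n m f nb mb =
      min ((n : ℝ) + f + max ((nb : ℝ) - f) 0)
        (min (2 * (n : ℝ) + 2 * nb) (min (m : ℝ) (2 * f))) := by
  have hmax : (f : ℝ) + max ((nb : ℝ) - f) 0 = max (f : ℝ) nb := by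
    rw [← max_add_add_left, add_zero, add_sub_cancel, max_comm]
  rw [sumCapacity_eq n m f nb mb h, add_assoc, hmax]
  push_cast
  rfl
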